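/- arXiv:2602.03702 — 6 statements merged into one kernel-verified Lean document; each statement's English description precedes it below -/
import Mathlib

section
/- For every γ ∈ (0,1) there is a constant C_γ > 0 such that for all reals η > 0, λ > 0 and every integer i ≥ 2: Σ_{p=1}^{⌊i/2⌋} p^(−2γ) · exp(−η λ (i^(1−γ) − p^(1−γ))) ≤ C_γ · exp(−((1−γ)/2)·η λ i^(1−γ)) · S_i(γ), where S_i(γ) = i^(1−2γ) if γ < 1/2, S_i(γ) = 1 + log i if γ = 1/2, and S_i(γ) = 1 if γ > 1/2. -/
/-- The graph of `x ↦ x ^ b`, `0 ≤ b ≤ 1`, lies below its tangent at `y`. -/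
theorem Real.rpow_le_rpow_mul_one_add_mul {b x y : ℝ} (hb0 : 0 ≤ b) (hb1 : b ≤ 1)
    (hx : 0 ≤ x) (hy : 0 < y) : x ^ b ≤ y ^ b * (1 + b * (x / y - 1)) := by
  have hxy : 0 ≤ x / y := by positivity
  have h := rpow_one_add_le_one_add_mul_self (s := x / y - 1) (by linarith) hb0 hb1
  rw [add_sub_cancel, Real.div_rpow hx hy.le] at h
  have hyb : 0 < y ^ b := Real.rpow_pos_of_pos hy b
  rwa [div_le_iff₀' hyb] at h

theorem sum_Icc_rpow_neg_le {a : ℝ} (ha0 : 0 ≤ a) (ha1 : a < 1) (n : ℕ) :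
    ∑ p ∈ Finset.Icc 1 n, (p : ℝ) ^ (-a) ≤ (1 - a)⁻¹ * (n : ℝ) ^ (1 - a) := by
  have hb : 0 < 1 - a := by linarith
  induction n with
  | zero => simp [Real.zero_rpow hb.ne']
  | succ n ih =>
    rw [Finset.sum_Icc_succ_top (by lia)]
    have hy : (0 : ℝ) < ((n + 1 : ℕ) : ℝ) := by positivity
    have h := Real.rpow_le_rpow_mul_one_add_mul hb.le (by linarith) (Nat.cast_nonneg n) hy
    have hs : (n : ℝ) / ((n + 1 : ℕ) : ℝ) - 1 = -((n + 1 : ℕ) : ℝ)⁻¹ := by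
      push_cast
      field_simp
      ring
    have hp : ((n + 1 : ℕ) : ℝ) ^ (-a) =
        ((n + 1 : ℕ) : ℝ) ^ (1 - a) * ((n + 1 : ℕ) : ℝ)⁻¹ := by
      rw [← Real.rpow_neg_one, ← Real.rpow_add hy]
      ring_nf
    rw [hs] at h
    rw [inv_mul_eq_div, le_div_iff₀ hb] at ih ⊢
    rw [hp]
    linarith

theorem sum_Icc_inv_le_one_add_log (n : ℕ) :
    ∑ p ∈ Finset.Icc 1 n, (p : ℝ)⁻¹ ≤ 1 + Real.log n := by
  have h := harmonic_le_one_add_log n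
  rw [harmonic_eq_sum_Icc] at h
  push_cast at h
  exact h

theorem exists_sum_Icc_rpow_neg_two_mul_le {γ : ℝ} (hγ0 : 0 < γ) :
    ∃ C > 0, ∀ n i : ℕ, 1 ≤ n → n ≤ i →
      ∑ p ∈ Finset.Icc 1 n, (p : ℝ) ^ (-(2 * γ)) ≤
        C * (if γ < 1 / 2 then (i : ℝ) ^ (1 - 2 * γ)
             else if γ = 1 / 2 then 1 + Real.log i
             else 1) := by
  rcases lt_trichotomy γ (1 / 2) with h | h | h
  · have hb : 0 < 1 - 2 * γ := by linarith
    refine ⟨(1 - 2 * γ)⁻¹, by positivity, fun n i _ hni ↦ ?_⟩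
    rw [if_pos h]
    refine (sum_Icc_rpow_neg_le (by linarith) (by linarith) n).trans ?_
    gcongr
  · refine ⟨1, one_pos, fun n i hn hni ↦ ?_⟩
    rw [if_neg h.not_lt, if_pos h, one_mul]
    have hg : -(2 * γ) = -1 := by linarith
    simp only [hg, Real.rpow_neg_one]
    refine (sum_Icc_inv_le_one_add_log n).trans ?_
    have : (0 : ℝ) < n := by exact_mod_cast hn
    gcongr
  · have hs : Summable fun p : ℕ ↦ (p : ℝ) ^ (-(2 * γ)) :=
      Real.summable_nat_rpow.2 (by linarith)
    have hnn : ∀ p : ℕ, 0 ≤ (p : ℝ) ^ (-(2 * γ)) := fun p ↦ by positivity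
    refine ⟨∑' p : ℕ, (p : ℝ) ^ (-(2 * γ)), hs.tsum_pos hnn 1 (by simp), fun n i _ _ ↦ ?_⟩
    rw [if_neg h.not_gt, if_neg h.ne', mul_one]
    exact hs.sum_le_tsum _ fun p _ ↦ hnn p


open Finset in
/-- First-half variance sum bound: for every `γ ∈ (0,1)` there is `C_γ > 0` such that
for all `η, λ > 0` and integers `i ≥ 2`,
`Σ_{p=1}^{⌊i/2⌋} p^(−2γ) exp(−ηλ(i^(1−γ) − p^(1−γ)))
  ≤ C_γ exp(−((1−γ)/2)·ηλ·i^(1−γ)) · S_i(γ)`,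
where `S_i(γ) = i^(1−2γ)` if `γ < 1/2`, `1 + log i` if `γ = 1/2`, and `1` if `γ > 1/2`. -/
theorem variance_inner_first_half (γ : ℝ) (hγ0 : 0 < γ) (hγ1 : γ < 1) :
    ∃ C > 0, ∀ (η lam : ℝ), 0 < η → 0 < lam → ∀ i : ℕ, 2 ≤ i →
      ∑ p ∈ Icc 1 (i / 2),
          (p : ℝ) ^ (-(2 * γ)) *
            Real.exp (-(η * lam * ((i : ℝ) ^ (1 - γ) - (p : ℝ) ^ (1 - γ))))
        ≤ C * Real.exp (-((1 - γ) / 2 * (η * lam * (i : ℝ) ^ (1 - γ)))) *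
            (if γ < 1 / 2 then (i : ℝ) ^ (1 - 2 * γ)
             else if γ = 1 / 2 then 1 + Real.log i
             else 1) := by
  obtain ⟨C, hC, hsum⟩ := exists_sum_Icc_rpow_neg_two_mul_le hγ0
  refine ⟨C, hC, fun η lam hη hlam i hi ↦ ?_⟩
  have hi0 : (0 : ℝ) < i := by positivity
  rw [mul_right_comm]
  refine le_trans ?_ (mul_le_mul_of_nonneg_right (hsum (i / 2) i (by lia) (by lia))
    (Real.exp_pos _).le)
  rw [sum_mul]
  refine sum_le_sum fun p hp ↦ ?_
  have hpi : (p : ℝ) / i - 1 ≤ -(1 / 2) := by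
    have : 2 * p ≤ i := by have := (mem_Icc.1 hp).2; lia
    have : 2 * (p : ℝ) ≤ i := by exact_mod_cast this
    rw [sub_le_iff_le_add, div_le_iff₀ hi0]
    linarith
  have hgap : (1 - γ) / 2 * (i : ℝ) ^ (1 - γ) ≤ (i : ℝ) ^ (1 - γ) - (p : ℝ) ^ (1 - γ) := by
    have h := Real.rpow_le_rpow_mul_one_add_mul (b := 1 - γ) (by linarith) (by linarith)
      (Nat.cast_nonneg p) hi0
    have h' : (i : ℝ) ^ (1 - γ) * (1 + (1 - γ) * ((p : ℝ) / i - 1)) ≤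
        (i : ℝ) ^ (1 - γ) * (1 + (1 - γ) * -(1 / 2)) := by
      have : 0 ≤ 1 - γ := by linarith
      gcongr
    linarith
  refine mul_le_mul_of_nonneg_left (Real.exp_le_exp.2 (neg_le_neg ?_)) (by positivity)
  have := mul_le_mul_of_nonneg_left hgap (mul_pos hη hlam).le
  linarith
end

section
/- For every γ ∈ (0,1) there is a constant C_γ > 0 such that for all integers i ≥ 2 and all reals η > 0, λ > 0 with η·λ ≤ i^γ: Σ_{p=⌈i/2⌉}^{i} p^(−2γ) · exp(−η λ (i^(1−γ) − p^(1−γ))) ≤ C_γ · i^(−γ)/(η λ). -/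
/-- Tangent-line bound for the concave power `x ^ s` with `0 ≤ s ≤ 1`. -/
theorem mul_rpow_sub_one_mul_sub_le_rpow_sub_rpow {s x y : ℝ} (hs0 : 0 ≤ s) (hs1 : s ≤ 1)
    (hx : 0 < x) (hy : 0 ≤ y) : s * x ^ (s - 1) * (x - y) ≤ x ^ s - y ^ s := by
  have hu : (-1 : ℝ) ≤ y / x - 1 := by linarith [div_nonneg hy hx.le]
  have hb := rpow_one_add_le_one_add_mul_self hu hs0 hs1
  rw [add_sub_cancel, Real.div_rpow hy hx.le, div_le_iff₀ (Real.rpow_pos_of_pos hx s)] at hb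
  have hxs : (1 + s * (y / x - 1)) * x ^ s = x ^ s - s * x ^ (s - 1) * (x - y) := by
    rw [Real.rpow_sub_one hx.ne']
    field_simp
    ring
  linarith

/-- A reversed geometric sum with ratio `exp (-c)`, `0 < c ≤ 1`, is at most `2 / c`. -/
theorem sum_Icc_exp_neg_mul_sub_le {c : ℝ} (hc0 : 0 < c) (hc1 : c ≤ 1) (m n : ℕ) :
    ∑ p ∈ Finset.Icc m n, Real.exp (-(c * ((n : ℝ) - p))) ≤ 2 / c := by
  have hr : Real.exp (-c) ≤ 1 - c / 2 := by
    rw [Real.exp_neg]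
    refine (inv_anti₀ (by linarith) (Real.add_one_le_exp c)).trans ?_
    rw [inv_le_iff_one_le_mul₀ (by linarith)]
    nlinarith
  calc ∑ p ∈ Finset.Icc m n, Real.exp (-(c * ((n : ℝ) - p)))
      ≤ ∑ p ∈ Finset.range (n + 1), Real.exp (-(c * ((n : ℝ) - p))) := by
        refine Finset.sum_le_sum_of_subset_of_nonneg (fun p hp => ?_)
          fun _ _ _ => (Real.exp_pos _).le
        rw [Finset.mem_Icc] at hp
        rw [Finset.mem_range]
        omega
    _ = ∑ k ∈ Finset.range (n + 1), Real.exp (-c) ^ k := by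
        rw [← Finset.sum_range_reflect]
        refine Finset.sum_congr rfl fun k hk => ?_
        have hk' : k ≤ n := by
          rw [Finset.mem_range] at hk
          omega
        rw [← Real.exp_nat_mul, Nat.add_sub_cancel, Nat.cast_sub hk']
        congr 1
        ring
    _ ≤ 2 / c := by
        have hg := mul_neg_geom_sum (Real.exp (-c)) (n + 1)
        have hp : 0 < Real.exp (-c) ^ (n + 1) := by positivity
        have hS : 0 ≤ ∑ k ∈ Finset.range (n + 1), Real.exp (-c) ^ k := by positivity
        rw [le_div_iff₀ hc0]
        nlinarith

open Finset in
/-- Second-half variance sum bound: for every `γ ∈ (0,1)` there is `C_γ > 0` such that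
for all integers `i ≥ 2` and reals `η, λ > 0` with `ηλ ≤ i^γ`,
`Σ_{p=⌈i/2⌉}^{i} p^(−2γ) exp(−ηλ(i^(1−γ) − p^(1−γ))) ≤ C_γ · i^(−γ)/(ηλ)`. -/
theorem variance_inner_second_half (γ : ℝ) (hγ0 : 0 < γ) (hγ1 : γ < 1) :
    ∃ C > 0, ∀ i : ℕ, 2 ≤ i → ∀ (η lam : ℝ), 0 < η → 0 < lam →
      η * lam ≤ (i : ℝ) ^ γ →
      ∑ p ∈ Icc ((i + 1) / 2) i,
          (p : ℝ) ^ (-(2 * γ)) *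
            Real.exp (-(η * lam * ((i : ℝ) ^ (1 - γ) - (p : ℝ) ^ (1 - γ))))
        ≤ C * (i : ℝ) ^ (-γ) / (η * lam) := by
  have hs : 0 < 1 - γ := by linarith
  refine ⟨(2 : ℝ) ^ (2 * γ) * 2 / (1 - γ), by positivity, fun i hi η lam hη hlam hle => ?_⟩
  have hi0 : (0 : ℝ) < i := by exact_mod_cast (by omega : 0 < i)
  have ha : 0 < η * lam := mul_pos hη hlam
  generalize η * lam = a at ha hle ⊢
  have hq : 0 < (i : ℝ) ^ (-γ) := Real.rpow_pos_of_pos hi0 _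
  have hc0 : 0 < a * ((1 - γ) * (i : ℝ) ^ (-γ)) := by positivity
  have hc1 : a * ((1 - γ) * (i : ℝ) ^ (-γ)) ≤ 1 := by
    have h1 : a * (i : ℝ) ^ (-γ) ≤ 1 := by
      rw [Real.rpow_neg hi0.le, ← div_eq_mul_inv]
      exact div_le_one_of_le₀ hle (by positivity)
    have h2 : 0 < a * (i : ℝ) ^ (-γ) := by positivity
    nlinarith
  have hterm : ∀ p ∈ Icc ((i + 1) / 2) i,
      (p : ℝ) ^ (-(2 * γ)) * Real.exp (-(a * ((i : ℝ) ^ (1 - γ) - (p : ℝ) ^ (1 - γ))))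
        ≤ ((i : ℝ) / 2) ^ (-(2 * γ)) *
          Real.exp (-(a * ((1 - γ) * (i : ℝ) ^ (-γ)) * ((i : ℝ) - p))) := by
    intro p hp
    rw [mem_Icc] at hp
    have hip : (i : ℝ) / 2 ≤ p := by
      have : (i : ℝ) ≤ 2 * p := by exact_mod_cast (by omega : i ≤ 2 * p)
      linarith
    have ht := mul_rpow_sub_one_mul_sub_le_rpow_sub_rpow hs.le (by linarith) hi0
      (Nat.cast_nonneg (α := ℝ) p)
    rw [show 1 - γ - 1 = -γ by ring] at ht
    refine mul_le_mul (Real.rpow_le_rpow_of_nonpos (by positivity) hip (by linarith))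
      (Real.exp_le_exp.2 ?_) (Real.exp_pos _).le (by positivity)
    rw [mul_assoc a]
    exact neg_le_neg (mul_le_mul_of_nonneg_left ht ha.le)
  refine (sum_le_sum hterm).trans ?_
  rw [← mul_sum]
  refine (mul_le_mul_of_nonneg_left (sum_Icc_exp_neg_mul_sub_le hc0 hc1 _ i)
    (by positivity)).trans_eq ?_
  have hpow : ((i : ℝ) / 2) ^ (-(2 * γ)) =
      (2 : ℝ) ^ (2 * γ) * ((i : ℝ) ^ (-γ) * (i : ℝ) ^ (-γ)) := by
    rw [Real.div_rpow hi0.le zero_le_two, Real.rpow_neg zero_le_two, ← Real.rpow_add hi0,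
      div_inv_eq_mul, mul_comm, show -γ + -γ = -(2 * γ) by ring]
  rw [hpow]
  generalize (i : ℝ) ^ (-γ) = q at hq ⊢
  field_simp
end

section
/- For every a > 1 there is a constant C_a > 0 such that for all γ ∈ (0,1), η ∈ (0,1], σ ≥ 0 and every integer N ≥ 3 with η·N^(1−γ) ≥ log N, defining k★ = max{k ≥ 1 : k^(−a) ≥ (log N)/(η N^(1−γ))}, one has both σ²·N^(−γ)·Σ_{k>k★} k^(−a) ≤ C_a · (log N) · σ² k★/(η N) and σ²·η·N^(1−2γ)·Σ_{k>k★} k^(−2a) ≤ C_a · (log N)² · σ² k★/(η N). -/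
lemma sub_one_mul_rpow_neg_le {s x : ℝ} (hs : 1 < s) (hx : 0 < x) :
    (s - 1) * (x + 1) ^ (-s) ≤ x ^ (1 - s) - (x + 1) ^ (1 - s) := by
  have hy : 0 < x + 1 := by linarith
  have hq : 0 < x / (x + 1) := by positivity
  have hlog : Real.log (x / (x + 1)) ≤ -(1 / (x + 1)) := by
    calc Real.log (x / (x + 1)) ≤ x / (x + 1) - 1 := Real.log_le_sub_one_of_pos hq
      _ = -(1 / (x + 1)) := by field_simp; ring
  have hbern : 1 + (s - 1) * (1 / (x + 1)) ≤ (x / (x + 1)) ^ (1 - s) := by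
    rw [Real.rpow_def_of_pos hq]
    nlinarith [Real.add_one_le_exp (Real.log (x / (x + 1)) * (1 - s)),
      mul_le_mul_of_nonneg_left hlog (sub_pos.2 hs).le]
  have hmul : (x / (x + 1)) ^ (1 - s) * (x + 1) ^ (1 - s) = x ^ (1 - s) := by
    rw [← Real.mul_rpow hq.le hy.le, div_mul_cancel₀ _ hy.ne']
  have hsplit : (x + 1) ^ (1 - s) = (x + 1) * (x + 1) ^ (-s) := by
    rw [sub_eq_add_neg, Real.rpow_add hy, Real.rpow_one]
  have hpos : 0 < (x + 1) ^ (1 - s) := Real.rpow_pos_of_pos hy _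
  have hcancel : (s - 1) * (1 / (x + 1)) * (x + 1) ^ (1 - s) = (s - 1) * (x + 1) ^ (-s) := by
    rw [hsplit]; field_simp
  have := mul_le_mul_of_nonneg_right hbern hpos.le
  rw [hmul, add_mul, hcancel] at this
  linarith

lemma tsum_rpow_neg_tail_le {s : ℝ} (hs : 1 < s) {K : ℕ} (hK : 1 ≤ K) :
    ∑' k : ℕ, ((K + 1 + k : ℕ) : ℝ) ^ (-s) ≤ (K : ℝ) ^ (1 - s) / (s - 1) := by
  have hs' : 0 < s - 1 := by linarith
  have hK' : (0 : ℝ) < K := by exact_mod_cast hK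
  refine Real.tsum_le_of_sum_range_le (fun k ↦ by positivity) fun n ↦ ?_
  have key : ∑ k ∈ Finset.range n, ((K + 1 + k : ℕ) : ℝ) ^ (-s)
      ≤ ((K : ℝ) ^ (1 - s) - ((K : ℝ) + n) ^ (1 - s)) / (s - 1) := by
    induction n with
    | zero => simp
    | succ n ih =>
      rw [Finset.sum_range_succ]
      have hstep := sub_one_mul_rpow_neg_le hs (x := (K : ℝ) + n) (by positivity)
      rw [le_div_iff₀ hs'] at ih ⊢
      have e : ((K + 1 + n : ℕ) : ℝ) = (K : ℝ) + n + 1 := by push_cast; ring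
      have e' : (K : ℝ) + (n + 1 : ℕ) = (K : ℝ) + n + 1 := by push_cast; ring
      rw [e, e']
      linarith
  refine key.trans ?_
  gcongr
  have : 0 ≤ ((K : ℝ) + n) ^ (1 - s) := by positivity
  linarith

lemma rpow_one_sub_le_two_rpow_mul {s : ℝ} (hs : 0 ≤ s) {K : ℕ} (hK : 1 ≤ K) :
    (K : ℝ) ^ (1 - s) ≤ 2 ^ s * K * ((K + 1 : ℕ) : ℝ) ^ (-s) := by
  have hK' : (1 : ℝ) ≤ K := by exact_mod_cast hK
  have hK0 : (0 : ℝ) < K := by linarith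
  have h : (2 * (K : ℝ)) ^ (-s) ≤ ((K + 1 : ℕ) : ℝ) ^ (-s) := by
    apply Real.rpow_le_rpow_of_nonpos (by positivity) _ (by linarith)
    push_cast; linarith
  calc (K : ℝ) ^ (1 - s) = 2 ^ s * K * (2 * (K : ℝ)) ^ (-s) := by
        rw [Real.mul_rpow (by norm_num) hK0.le, sub_eq_add_neg, Real.rpow_add hK0, Real.rpow_one,
          Real.rpow_neg (by norm_num : (0 : ℝ) ≤ 2)]
        have : (2 : ℝ) ^ s ≠ 0 := by positivity
        field_simp
    _ ≤ _ := by gcongr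

/-- The tail `∑_{k > K} k ^ (-s)` is at most a constant times `K * (K + 1) ^ (-s)`. -/
lemma tsum_rpow_neg_tail_le_mul {s : ℝ} (hs : 1 < s) {K : ℕ} (hK : 1 ≤ K) :
    ∑' k : ℕ, ((K + 1 + k : ℕ) : ℝ) ^ (-s)
      ≤ 2 ^ s / (s - 1) * (K * ((K + 1 : ℕ) : ℝ) ^ (-s)) := by
  have hs' : 0 < s - 1 := by linarith
  calc _ ≤ (K : ℝ) ^ (1 - s) / (s - 1) := tsum_rpow_neg_tail_le hs hK
    _ ≤ 2 ^ s * K * ((K + 1 : ℕ) : ℝ) ^ (-s) / (s - 1) := by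
        gcongr
        exact rpow_one_sub_le_two_rpow_mul (by linarith) hK
    _ = _ := by ring


/-- Variance-tail domination under a power-law spectrum: for every `a > 1` there is
`C_a > 0` such that for all `γ ∈ (0,1)`, `η ∈ (0,1]`, `σ ≥ 0` and every integer
`N ≥ 3` with `η N^(1−γ) ≥ log N`, with
`k★ = max{k ≥ 1 : k^(−a) ≥ log N/(η N^(1−γ))}`, both
`σ² N^(−γ) Σ_{k>k★} k^(−a) ≤ C_a (log N) σ²k★/(ηN)` and
`σ² η N^(1−2γ) Σ_{k>k★} k^(−2a) ≤ C_a (log N)² σ²k★/(ηN)`. -/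
theorem variance_tail_dominated (a : ℝ) (ha : 1 < a) :
    ∃ C > 0, ∀ (γ η σ : ℝ) (N kstar : ℕ),
      0 < γ → γ < 1 → 0 < η → η ≤ 1 → 0 ≤ σ → 3 ≤ N →
      Real.log N ≤ η * (N : ℝ) ^ (1 - γ) →
      1 ≤ kstar →
      Real.log N / (η * (N : ℝ) ^ (1 - γ)) ≤ (kstar : ℝ) ^ (-a) →
      (∀ k : ℕ, kstar < k → (k : ℝ) ^ (-a) < Real.log N / (η * (N : ℝ) ^ (1 - γ))) →
      σ ^ 2 * (N : ℝ) ^ (-γ) * (∑' k : ℕ, ((kstar + 1 + k : ℕ) : ℝ) ^ (-a))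
          ≤ C * Real.log N * (σ ^ 2 * (kstar : ℝ) / (η * N)) ∧
        σ ^ 2 * η * (N : ℝ) ^ (1 - 2 * γ) *
            (∑' k : ℕ, ((kstar + 1 + k : ℕ) : ℝ) ^ (-(2 * a)))
          ≤ C * (Real.log N) ^ 2 * (σ ^ 2 * (kstar : ℝ) / (η * N)) := by
  have ha' : 0 < a - 1 := by linarith
  refine ⟨2 ^ (2 * a) / (a - 1), by positivity, ?_⟩
  intro γ η σ N K _ _ hη _ _ hN _ hK _ hmax
  have hN0 : (0 : ℝ) < N := by exact_mod_cast (by omega : 0 < N)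
  have hcut := (hmax (K + 1) K.lt_succ_self).le
  have hpow : ((K + 1 : ℕ) : ℝ) ^ (-(2 * a)) = (((K + 1 : ℕ) : ℝ) ^ (-a)) ^ 2 := by
    rw [← Real.rpow_natCast, ← Real.rpow_mul (by positivity)]
    congr 1; push_cast; ring
  have hγ : (N : ℝ) ^ (1 - γ) = N * (N : ℝ) ^ (-γ) := by
    rw [sub_eq_add_neg, Real.rpow_add hN0, Real.rpow_one]
  have h2γ : (N : ℝ) ^ (1 - 2 * γ) = N * ((N : ℝ) ^ (-γ)) ^ 2 := by
    rw [sub_eq_add_neg, Real.rpow_add hN0, Real.rpow_one, ← Real.rpow_natCast,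
      ← Real.rpow_mul hN0.le]
    congr 2; push_cast; ring
  have hg : 0 < (N : ℝ) ^ (-γ) := by positivity
  rw [hγ] at hcut
  rw [h2γ]
  have htail₁ : ∑' k : ℕ, ((K + 1 + k : ℕ) : ℝ) ^ (-a)
      ≤ 2 ^ (2 * a) / (a - 1) * (K * (Real.log N / (η * (N * (N : ℝ) ^ (-γ))))) := by
    refine (tsum_rpow_neg_tail_le_mul ha hK).trans ?_
    gcongr
    · norm_num
    · linarith
  have htail₂ : ∑' k : ℕ, ((K + 1 + k : ℕ) : ℝ) ^ (-(2 * a))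
      ≤ 2 ^ (2 * a) / (a - 1) * (K * (Real.log N / (η * (N * (N : ℝ) ^ (-γ)))) ^ 2) := by
    refine (tsum_rpow_neg_tail_le_mul (by linarith) hK).trans ?_
    rw [hpow]
    gcongr
    linarith
  generalize (N : ℝ) ^ (-γ) = g at *
  constructor
  · refine (mul_le_mul_of_nonneg_left htail₁ (by positivity)).trans_eq ?_
    field_simp
  · refine (mul_le_mul_of_nonneg_left htail₂ (by positivity)).trans_eq ?_
    field_simp
end

section
/- Let a > 0, b > 1 and c > 0 be reals. There exists a constant C (depending only on a, b, c) such that for every real T ≥ 1: Σ_{k=1}^{∞} k^(−b) · exp(−c · k^(−a) · T) ≤ C · T^(−(b−1)/a). -/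
lemma Real.rpow_le_rpow_mul_exp {y s : ℝ} (hy : 0 ≤ y) (hs : 0 < s) :
    y ^ s ≤ s ^ s * Real.exp y := by
  have h : y ≤ s * Real.exp (y / s) := by
    have := Real.add_one_le_exp (y / s)
    calc y = s * (y / s) := by field_simp
      _ ≤ s * Real.exp (y / s) := by gcongr; linarith
  calc y ^ s ≤ (s * Real.exp (y / s)) ^ s := by gcongr
    _ = s ^ s * Real.exp y := by
      rw [Real.mul_rpow hs.le (Real.exp_pos _).le, ← Real.exp_mul, div_mul_cancel₀ _ hs.ne']

lemma one_add_rpow_le_mul_exp_rpow {a b c u : ℝ} (ha : 0 < a) (hb : 0 < b) (hc : 0 < c)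
    (hu : 0 ≤ u) :
    (1 + u) ^ b ≤ 2 ^ b * (1 + (b / a / c) ^ (b / a)) * Real.exp (c * u ^ a) := by
  have hs : 0 < b / a := by positivity
  have he : 1 ≤ Real.exp (c * u ^ a) := Real.one_le_exp (by positivity)
  have hK : 0 ≤ (b / a / c) ^ (b / a) := by positivity
  have key : u ^ b ≤ (b / a / c) ^ (b / a) * Real.exp (c * u ^ a) := by
    have h := Real.rpow_le_rpow_mul_exp (y := c * u ^ a) (by positivity) hs
    rw [Real.mul_rpow hc.le (by positivity), ← Real.rpow_mul hu,
      mul_div_cancel₀ _ ha.ne'] at h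
    rw [Real.div_rpow hs.le hc.le, div_mul_eq_mul_div, le_div_iff₀ (by positivity)]
    linarith
  have hmax : (1 + u) ^ b ≤ 2 ^ b * max 1 (u ^ b) := by
    rcases le_total u 1 with h | h
    · calc (1 + u) ^ b ≤ 2 ^ b := by gcongr; linarith
        _ ≤ 2 ^ b * max 1 (u ^ b) := le_mul_of_one_le_right (by positivity) (le_max_left _ _)
    · calc (1 + u) ^ b ≤ (2 * u) ^ b := by gcongr; linarith
        _ = 2 ^ b * u ^ b := Real.mul_rpow (by norm_num) hu
        _ ≤ 2 ^ b * max 1 (u ^ b) := by gcongr; exact le_max_right _ _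
  refine hmax.trans ?_
  rw [mul_assoc]
  gcongr
  refine max_le ?_ ?_ <;> nlinarith

lemma tsum_add_add_one_rpow_neg_le {b M : ℝ} (hb : 1 < b) (hM : 0 < M) :
    Summable (fun k : ℕ ↦ (M + ((k : ℝ) + 1)) ^ (-b)) ∧
      ∑' k : ℕ, (M + ((k : ℝ) + 1)) ^ (-b) ≤ M ^ (1 - b) / (b - 1) := by
  have anti : AntitoneOn (fun t : ℝ ↦ (M + t) ^ (-b)) (Set.Ici 0) := fun x hx y _ hxy ↦ by
    have hx' : 0 ≤ x := hx
    exact Real.rpow_le_rpow_of_nonpos (by positivity) (by linarith) (by linarith)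
  have integrable : MeasureTheory.IntegrableOn (fun t : ℝ ↦ (M + t) ^ (-b)) (Set.Ioi 0) := by
    simpa only [add_comm M] using
      integrableOn_add_rpow_Ioi_of_lt (a := -b) (c := 0) (m := M) (by linarith) (by linarith)
  have nonneg : ∀ t ∈ Set.Ioi (0 : ℝ), 0 ≤ (M + t) ^ (-b) := fun t ht ↦ by
    have ht' : 0 < t := ht
    positivity
  have hint : ∫ t in Set.Ioi (0 : ℝ), (M + t) ^ (-b) = M ^ (1 - b) / (b - 1) := by
    have h := (MeasureTheory.measurePreserving_add_left MeasureTheory.volume M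
      ).setIntegral_preimage_emb (measurableEmbedding_addLeft M) (fun t : ℝ ↦ t ^ (-b)) (Set.Ioi M)
    rw [Set.preimage_const_add_Ioi, sub_self, integral_Ioi_rpow_of_lt (by linarith) hM] at h
    rw [h, show -b + 1 = -(b - 1) by ring, neg_div_neg_eq, neg_sub]
  refine ⟨?_, ?_⟩
  · simpa using (summable_nat_add_iff 1).2
      (anti.summable_of_integrableOn_Ioi_zero integrable nonneg)
  · rw [← hint]
    simpa using anti.tsum_add_one_le_integral integrable nonneg

/-- Laplace-type power-law bound: for reals `a > 0`, `b > 1`, `c > 0` there is a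
constant `C` such that for every real `T ≥ 1`,
`Σ_{k=1}^∞ k^(−b) exp(−c k^(−a) T) ≤ C T^(−(b−1)/a)`. -/
theorem laplace_power_law_bound (a b c : ℝ) (ha : 0 < a) (hb : 1 < b) (hc : 0 < c) :
    ∃ C : ℝ, ∀ T : ℝ, 1 ≤ T →
      (∑' k : ℕ, ((k : ℝ) + 1) ^ (-b) * Real.exp (-c * ((k : ℝ) + 1) ^ (-a) * T))
        ≤ C * T ^ (-((b - 1) / a)) := by
  refine ⟨2 ^ b * (1 + (b / a / c) ^ (b / a)) / (b - 1), fun T hT ↦ ?_⟩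
  set K : ℝ := 2 ^ b * (1 + (b / a / c) ^ (b / a))
  have hb0 : 0 < b := by linarith
  have hT0 : 0 < T := by linarith
  have hKpos : 0 < K := by positivity
  have hM : 0 < T ^ (1 / a) := by positivity
  obtain ⟨hsum, hle⟩ := tsum_add_add_one_rpow_neg_le hb hM
  have hterm (k : ℕ) : ((k : ℝ) + 1) ^ (-b) * Real.exp (-c * ((k : ℝ) + 1) ^ (-a) * T)
      ≤ K * (T ^ (1 / a) + ((k : ℝ) + 1)) ^ (-b) := by
    have hx : (0 : ℝ) < (k : ℝ) + 1 := by positivity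
    generalize (k : ℝ) + 1 = x at hx ⊢
    have h := one_add_rpow_le_mul_exp_rpow (u := T ^ (1 / a) / x) ha hb0 hc (by positivity)
    have hu : -c * x ^ (-a) * T = -(c * (T ^ (1 / a) / x) ^ a) := by
      rw [Real.div_rpow hM.le hx.le, ← Real.rpow_mul hT0.le, one_div_mul_cancel ha.ne',
        Real.rpow_one, Real.rpow_neg hx.le]
      ring
    have hsplit : T ^ (1 / a) + x = x * (1 + T ^ (1 / a) / x) := by field_simp; ring
    rw [hu, hsplit, Real.mul_rpow hx.le (by positivity), mul_left_comm, Real.exp_neg,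
      Real.rpow_neg (x := 1 + T ^ (1 / a) / x) (by positivity)]
    gcongr
    rw [← div_eq_mul_inv, inv_le_comm₀ (Real.exp_pos _) (by positivity), inv_div,
      div_le_iff₀ hKpos]
    linarith
  have hKsum := hsum.mul_left K
  calc _ ≤ ∑' k : ℕ, K * (T ^ (1 / a) + ((k : ℝ) + 1)) ^ (-b) :=
        (Summable.of_nonneg_of_le (fun k ↦ by positivity) hterm hKsum).tsum_le_tsum hterm hKsum
    _ = K * ∑' k : ℕ, (T ^ (1 / a) + ((k : ℝ) + 1)) ^ (-b) := tsum_mul_left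
    _ ≤ K * ((T ^ (1 / a)) ^ (1 - b) / (b - 1)) := by gcongr
    _ = K / (b - 1) * T ^ (-((b - 1) / a)) := by
      rw [← Real.rpow_mul hT0.le, show 1 / a * (1 - b) = -((b - 1) / a) by ring]
      ring
end

section
/- There exist a constant C (depending only on a, b, ρ, η and σ) and an absolute constant c such that for every integer N ≥ 3 with ⌊ρN⌋ ≥ 1 and N − ⌊ρN⌋ ≥ 2: bias_N + variance_N ≤ C · (1 + log N)^c · ( N^(−(b−1)/a) + N^(−(a−1)/a) ). -/
/-- The warmup-stable-decay step-size schedule (stable then linear decay): `η_t = η` for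
`t ≤ t₀` and `η_t = η(1 − (t − t₀)/(N − t₀))` for `t > t₀`. -/
noncomputable def wsdStep (η : ℝ) (t0 N t : ℕ) : ℝ :=
  if t ≤ t0 then η else η * (1 - ((t : ℝ) - (t0 : ℝ)) / ((N : ℝ) - (t0 : ℝ)))

open Finset in
theorem sum_Ico_reverse_linear (q p : ℕ) :
    ∑ s ∈ Ico (p + 1) (p + 1 + q), (((p + 1 + q : ℕ) : ℝ) - s) = q * (q + 1) / 2 := by
  induction q generalizing p with
  | zero => simp
  | succ q ih =>
    rw [sum_eq_sum_Ico_succ_bot (by omega)]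
    have h := ih (p + 1)
    rw [show p + 1 + 1 + q = p + 1 + (q + 1) by ring] at h
    rw [h]
    push_cast
    ring

open Finset in
theorem sq_sub_one_le_sum_Icc {p N : ℕ} (h : p < N) :
    (((N : ℝ) - p) ^ 2 - 1) / 4 ≤ ∑ s ∈ Icc (p + 1) (N - 1), ((N : ℝ) - s) := by
  obtain ⟨q, rfl⟩ := Nat.exists_eq_add_of_lt h
  have hI : Icc (p + 1) (p + q + 1 - 1) = Ico (p + 1) (p + 1 + q) := by
    ext s
    simp only [mem_Icc, mem_Ico]
    omega
  have hs := sum_Ico_reverse_linear q p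
  rw [show p + 1 + q = p + q + 1 by ring] at hs
  rw [hI, show p + 1 + q = p + q + 1 by ring, hs]
  push_cast
  nlinarith [sq_nonneg (q : ℝ)]

open Finset in
theorem sum_range_inv_le_one_add_log (n : ℕ) :
    ∑ k ∈ range n, ((k : ℝ) + 1)⁻¹ ≤ 1 + Real.log n := by
  have h := harmonic_le_one_add_log n
  simpa [harmonic] using h

theorem exp_neg_le_rpow {m y : ℝ} (hm : 0 < m) (hy : 0 < y) :
    Real.exp (-y) ≤ m ^ m * y ^ (-m) := by
  have h1 : y / m ≤ Real.exp (y / m) := by linarith [Real.add_one_le_exp (y / m)]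
  have h2 : (y / m) ^ m ≤ Real.exp y := by
    calc (y / m) ^ m ≤ Real.exp (y / m) ^ m := Real.rpow_le_rpow (by positivity) h1 hm.le
      _ = Real.exp y := by rw [← Real.exp_mul]; congr 1; field_simp
  rw [Real.exp_neg, Real.rpow_neg hy.le, ← div_eq_mul_inv, ← inv_div,
    ← Real.div_rpow hy.le hm.le]
  exact inv_anti₀ (by positivity) h2

theorem summable_add_one_rpow_neg {b : ℝ} (hb : 1 < b) :
    Summable fun k : ℕ => ((k : ℝ) + 1) ^ (-b) := by
  have h := (summable_nat_add_iff 1).mpr (Real.summable_nat_rpow.mpr (show -b < -1 by linarith))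
  simpa using h

theorem summable_rpow_mul_exp {b : ℝ} (hb : 1 < b) (a : ℝ) {y : ℝ} (hy : 0 ≤ y) :
    Summable fun k : ℕ => ((k : ℝ) + 1) ^ (-b) * Real.exp (-(y * ((k : ℝ) + 1) ^ (-a))) := by
  refine (summable_add_one_rpow_neg hb).of_nonneg_of_le (fun k => by positivity) fun k => ?_
  exact mul_le_of_le_one_right (by positivity) (Real.exp_le_one_iff.mpr (by
    have : 0 ≤ y * ((k : ℝ) + 1) ^ (-a) := by positivity
    linarith))

open Finset in
/-- A power-law spectral sum damped over an effective horizon `x ≤ N` decays like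
`x ^ (-(b - 1) / a)` up to a logarithm of `N`. -/
theorem tsum_rpow_mul_exp_le {a b κ : ℝ} (ha : 1 < a) (hb : 1 < b) (hκ : 0 < κ) :
    ∃ C > 0, ∀ (N : ℕ) (x : ℝ), 1 ≤ N → 0 < x → x ≤ N →
      ∑' k : ℕ, ((k : ℝ) + 1) ^ (-b) * Real.exp (-(κ * x * ((k : ℝ) + 1) ^ (-a))) ≤
        C * (1 + Real.log N) * x ^ (-((b - 1) / a)) := by
  set m := (b - 1) / a with hm_def
  have hm : 0 < m := div_pos (by linarith) (by linarith)
  set S := ∑' k : ℕ, ((k : ℝ) + 1) ^ (-((b + 1) / 2))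
  have hSs := summable_add_one_rpow_neg (show 1 < (b + 1) / 2 by linarith)
  have hS : 0 ≤ S := tsum_nonneg fun k => by positivity
  set A := m ^ m * κ ^ (-m)
  have hA : 0 < A := by positivity
  refine ⟨2 * A + S, by positivity, fun N x hN hx hxN => ?_⟩
  have hN' : (1 : ℝ) ≤ N := by exact_mod_cast hN
  have hL : 0 ≤ Real.log N := Real.log_nonneg hN'
  have hsum := summable_rpow_mul_exp hb a (show 0 ≤ κ * x by positivity)
  obtain ⟨M, hM⟩ : ∃ M : ℕ, M = N ^ 2 := ⟨_, rfl⟩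
  have hM' : (M : ℝ) = (N : ℝ) ^ 2 := by rw [hM]; push_cast; rfl
  rw [← hsum.sum_add_tsum_nat_add M]
  have head : ∑ k ∈ range M,
      ((k : ℝ) + 1) ^ (-b) * Real.exp (-(κ * x * ((k : ℝ) + 1) ^ (-a))) ≤
        A * x ^ (-m) * (1 + 2 * Real.log N) := by
    calc _ ≤ ∑ k ∈ range M, A * x ^ (-m) * ((k : ℝ) + 1)⁻¹ := by
          refine sum_le_sum fun k _ => ?_
          have hk : (0 : ℝ) < (k : ℝ) + 1 := by positivity
          calc _ ≤ ((k : ℝ) + 1) ^ (-b) * (m ^ m * (κ * x * ((k : ℝ) + 1) ^ (-a)) ^ (-m)) := by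
                gcongr
                exact exp_neg_le_rpow hm (by positivity)
            _ = A * x ^ (-m) * (((k : ℝ) + 1) ^ (-b) * ((k : ℝ) + 1) ^ (-a * -m)) := by
                rw [Real.mul_rpow (by positivity) (by positivity),
                  Real.mul_rpow hκ.le hx.le, ← Real.rpow_mul hk.le]
                ring
            _ = _ := by
                rw [← Real.rpow_add hk, ← Real.rpow_neg_one ((k : ℝ) + 1)]
                congr 2
                rw [hm_def]
                field_simp
                ring
      _ ≤ _ := by
          rw [← mul_sum]
          gcongr
          refine (sum_range_inv_le_one_add_log _).trans ?_
          rw [hM', Real.log_pow]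
          norm_num
  have tail : ∑' k : ℕ, ((((k + M : ℕ) : ℝ)) + 1) ^ (-b) *
      Real.exp (-(κ * x * ((((k + M : ℕ) : ℝ)) + 1) ^ (-a))) ≤ S * x ^ (-m) := by
    calc _ ≤ ∑' k : ℕ, ((k : ℝ) + 1) ^ (-((b + 1) / 2)) * x ^ (-m) := by
          have hsum' := (summable_nat_add_iff M).mpr hsum
          refine Summable.tsum_le_tsum (fun k => ?_) hsum' (hSs.mul_right _)
          set j : ℝ := (((k + M : ℕ) : ℝ)) + 1 with hj
          have hjk : (k : ℝ) + 1 ≤ j := by rw [hj]; push_cast; linarith [Nat.cast_nonneg (α := ℝ) M]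
          have hjN : (N : ℝ) ^ (2 : ℝ) ≤ j := by
            rw [hj, Real.rpow_two, ← hM']; push_cast; linarith [Nat.cast_nonneg (α := ℝ) k]
          have hk : (0 : ℝ) < (k : ℝ) + 1 := by positivity
          have hj0 : 0 < j := hk.trans_le hjk
          calc j ^ (-b) * Real.exp (-(κ * x * j ^ (-a))) ≤ j ^ (-b) := by
                refine mul_le_of_le_one_right (by positivity) (Real.exp_le_one_iff.mpr ?_)
                have : 0 ≤ κ * x * j ^ (-a) := by positivity
                linarith
            _ = j ^ (-((b + 1) / 2)) * j ^ (-((b - 1) / 2)) := by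
                rw [← Real.rpow_add hj0]; congr 1; ring
            _ ≤ ((k : ℝ) + 1) ^ (-((b + 1) / 2)) * x ^ (-m) := by
                gcongr ?_ * ?_
                · exact Real.rpow_le_rpow_of_nonpos hk hjk (by linarith)
                · calc j ^ (-((b - 1) / 2)) ≤ ((N : ℝ) ^ (2 : ℝ)) ^ (-((b - 1) / 2)) :=
                        Real.rpow_le_rpow_of_nonpos (by positivity) hjN (by linarith)
                    _ = (N : ℝ) ^ (-(b - 1)) := by
                        rw [← Real.rpow_mul (by positivity)]; congr 1; ring
                    _ ≤ (N : ℝ) ^ (-m) := by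
                        refine Real.rpow_le_rpow_of_exponent_le hN' (neg_le_neg ?_)
                        exact div_le_self (by linarith) ha.le
                    _ ≤ x ^ (-m) := Real.rpow_le_rpow_of_nonpos hx hxN (by linarith)
      _ = S * x ^ (-m) := tsum_mul_right
  have hxm : 0 < x ^ (-m) := by positivity
  calc _ ≤ A * x ^ (-m) * (1 + 2 * Real.log N) + S * x ^ (-m) := add_le_add head tail
    _ ≤ (2 * A + S) * (1 + Real.log N) * x ^ (-m) := by
        nlinarith [mul_pos hA hxm, mul_nonneg (mul_nonneg hS hL) hxm.le]

theorem wsdStep_lower {η : ℝ} {t0 N t : ℕ} (hη : 0 ≤ η) (h0 : t0 < N) (ht : t ≤ N) :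
    η / N * (N - t) ≤ wsdStep η t0 N t := by
  have h0' : (t0 : ℝ) < N := by exact_mod_cast h0
  have hN : (0 : ℝ) < N := (Nat.cast_nonneg t0).trans_lt h0'
  have ht' : (t : ℝ) ≤ N := by exact_mod_cast ht
  unfold wsdStep
  split_ifs with h
  · rw [div_mul_eq_mul_div, div_le_iff₀ hN]
    nlinarith [Nat.cast_nonneg (α := ℝ) t]
  · rw [one_sub_div (by linarith), div_mul_eq_mul_div, ← mul_div_assoc]
    rw [show (N : ℝ) - t0 - (t - t0) = N - t by ring]
    gcongr
    linarith

theorem wsdStep_upper {η ρ : ℝ} {t0 N t : ℕ} (hη : 0 ≤ η) (hρ : ρ < 1) (hN : 0 < N)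
    (h0 : (t0 : ℝ) ≤ ρ * N) (ht : t ≤ N) :
    wsdStep η t0 N t ≤ η / (1 - ρ) * ((N - t) / N) := by
  have hN : (0 : ℝ) < N := by exact_mod_cast hN
  have ht' : (t : ℝ) ≤ N := by exact_mod_cast ht
  have hρ' : 0 < 1 - ρ := by linarith
  have hgap : (1 - ρ) * N ≤ N - t0 := by linarith
  have hpos : 0 < (1 - ρ) * N := by positivity
  rw [div_mul_div_comm]
  unfold wsdStep
  split_ifs with h
  · have h' : (t : ℝ) ≤ t0 := by exact_mod_cast h
    rw [le_div_iff₀ hpos]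
    gcongr
    linarith
  · rw [one_sub_div (by linarith), ← mul_div_assoc]
    rw [show (N : ℝ) - t0 - (t - t0) = N - t by ring]
    gcongr

open Finset in
theorem exp_neg_sum_wsdStep_le {η l : ℝ} {t0 N p : ℕ} (hη : 0 ≤ η) (hl : 0 ≤ l) (hl1 : l ≤ 1)
    (h0 : t0 < N) (hp : p < N) :
    Real.exp (-2 * l * ∑ s ∈ Icc (p + 1) (N - 1), wsdStep η t0 N s) ≤
      Real.exp (η / 2) * Real.exp (-(η / 2 * (((N : ℝ) - p) ^ 2 / N) * l)) := by
  have hN : (1 : ℝ) ≤ N := by exact_mod_cast (by omega : 1 ≤ N)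
  have hsum : η / N * ((((N : ℝ) - p) ^ 2 - 1) / 4) ≤
      ∑ s ∈ Icc (p + 1) (N - 1), wsdStep η t0 N s := by
    calc _ ≤ η / N * ∑ s ∈ Icc (p + 1) (N - 1), ((N : ℝ) - s) := by
          gcongr
          exact sq_sub_one_le_sum_Icc hp
      _ ≤ _ := by
          rw [mul_sum]
          refine sum_le_sum fun s hs => wsdStep_lower hη h0 ?_
          have := (mem_Icc.mp hs).2
          omega
  rw [← Real.exp_add, Real.exp_le_exp]
  have h1 := mul_le_mul_of_nonneg_left hsum hl
  have h2 : l * (η / N) ≤ η := by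
    calc l * (η / N) ≤ 1 * (η / 1) := by gcongr
      _ = η := by ring
  have h3 : l * (η / N * ((((N : ℝ) - p) ^ 2 - 1) / 4)) =
      (η / 2 * (((N : ℝ) - p) ^ 2 / N) * l) / 2 - l * (η / N) / 4 := by ring
  linarith

open Finset in
theorem sum_sq_mul_rpow_le {a : ℝ} (ha : 1 < a) (ha2 : a ≤ 2) {N : ℕ} (hN : 1 ≤ N) :
    ∑ p ∈ Icc 1 (N - 1), (((N : ℝ) - p) / N) ^ 2 *
      (((N : ℝ) - p) ^ 2 / N) ^ (-((2 * a - 1) / a)) ≤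
        (1 + Real.log N) * (N : ℝ) ^ (-((a - 1) / a)) := by
  have hN0 : (0 : ℝ) < N := by exact_mod_cast hN
  calc _ ≤ ∑ p ∈ Icc 1 (N - 1), ((N : ℝ) - p)⁻¹ * (N : ℝ) ^ (-((a - 1) / a)) := by
        refine sum_le_sum fun p hp => ?_
        have hpN : (p : ℝ) < N := by
          have := (mem_Icc.mp hp).2
          exact_mod_cast (by omega : p < N)
        set q : ℝ := (N : ℝ) - p with hq
        have hq0 : 0 < q := by linarith
        have hqN : q ≤ N := by linarith [Nat.cast_nonneg (α := ℝ) p]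
        have e : (0 : ℝ) ≤ 2 / a - 1 := by
          rw [sub_nonneg, le_div_iff₀ (by linarith)]; linarith
        calc (q / N) ^ 2 * (q ^ 2 / N) ^ (-((2 * a - 1) / a))
            = q⁻¹ * (N : ℝ) ^ (-(1 / a)) * q ^ (2 / a - 1) := by
              rw [← Real.rpow_two, ← Real.rpow_two, Real.div_rpow hq0.le hN0.le,
                Real.div_rpow (by positivity) hN0.le, ← Real.rpow_mul hq0.le,
                ← Real.rpow_neg_one q, div_mul_div_comm, ← Real.rpow_add hq0,
                ← Real.rpow_add hN0, div_eq_mul_inv, ← Real.rpow_neg hN0.le, mul_right_comm,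
                ← Real.rpow_add hq0]
              congr 2 <;> field_simp <;> ring
          _ ≤ q⁻¹ * (N : ℝ) ^ (-(1 / a)) * (N : ℝ) ^ (2 / a - 1) := by gcongr
          _ = _ := by
              rw [mul_assoc, ← Real.rpow_add hN0]
              congr 2
              field_simp
              ring
    _ ≤ _ := by
        rw [← sum_mul]
        gcongr
        refine le_trans ?_ (sum_range_inv_le_one_add_log N)
        rw [← sum_range_reflect]
        calc ∑ p ∈ Icc 1 (N - 1), ((N : ℝ) - p)⁻¹
            = ∑ p ∈ Icc 1 (N - 1), (((N - 1 - p : ℕ) : ℝ) + 1)⁻¹ := by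
              refine sum_congr rfl fun p hp => ?_
              have := (mem_Icc.mp hp).2
              rw [Nat.cast_sub this, Nat.cast_sub hN]
              congr 1
              push_cast
              ring
          _ ≤ _ := by
              refine sum_le_sum_of_subset_of_nonneg (fun p hp => ?_) fun _ _ _ => by positivity
              have := (mem_Icc.mp hp).2
              exact mem_range.mpr (by omega)

open Finset in
/-- Deterministic core of Theorem 2 (excess-risk rate of the WSD schedule): there is an
absolute constant `c` and, for fixed `a ∈ (1,2)`, `b > 1`, `ρ ∈ (0,1)`, `σ ≥ 0` and base
step size `η > 0` with `η Σ_{k≥1} k^(−a) ≤ 1`, a constant `C > 0` such that for every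
integer `N ≥ 3` with `t₀ = ⌊ρN⌋ ≥ 1` and `N − t₀ ≥ 2`, the last-iterate bias and
variance surrogates for the WSD schedule with eigenvalues `λ_k = k^(−a)` and optimum
energies `v_k = k^(−b)` satisfy
`bias_N + variance_N ≤ C (1+log N)^c (N^(−(b−1)/a) + N^(−(a−1)/a))`. -/
theorem wsd_excess_risk_rate :
    ∃ c : ℕ, ∀ (a b ρ η σ : ℝ),
      1 < a → a < 2 → 1 < b → 0 < ρ → ρ < 1 → 0 ≤ σ → 0 < η →
      η * (∑' k : ℕ, ((k : ℝ) + 1) ^ (-a)) ≤ 1 →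
      ∃ C > 0, ∀ N : ℕ, 3 ≤ N →
        1 ≤ Nat.floor (ρ * (N : ℝ)) → 2 ≤ N - Nat.floor (ρ * (N : ℝ)) →
        -- bias_N
        (∑' k : ℕ, ((k : ℝ) + 1) ^ (-b) *
            Real.exp (-2 * ((k : ℝ) + 1) ^ (-a) *
              ∑ i ∈ Icc 1 (N - 1), wsdStep η (Nat.floor (ρ * (N : ℝ))) N i))
          -- variance_N
          + σ ^ 2 *
            ∑' k : ℕ, (((k : ℝ) + 1) ^ (-a)) ^ 2 *
              ∑ p ∈ Icc 1 (N - 1),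
                (wsdStep η (Nat.floor (ρ * (N : ℝ))) N p) ^ 2 *
                  Real.exp (-2 * ((k : ℝ) + 1) ^ (-a) *
                    ∑ s ∈ Icc (p + 1) (N - 1), wsdStep η (Nat.floor (ρ * (N : ℝ))) N s)
        ≤ C * (1 + Real.log N) ^ c *
            ((N : ℝ) ^ (-((b - 1) / a)) + (N : ℝ) ^ (-((a - 1) / a))) := by
  refine ⟨2, fun a b ρ η σ ha ha2 hb hρ hρ1 hσ hη _ => ?_⟩
  have hκ : 0 < η / 2 := by positivity
  obtain ⟨C₁, hC₁, hbias⟩ := tsum_rpow_mul_exp_le ha hb hκ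
  obtain ⟨C₂, hC₂, hvar⟩ := tsum_rpow_mul_exp_le ha (show 1 < 2 * a by linarith) hκ
  set E := Real.exp (η / 2)
  have hE : 0 < E := Real.exp_pos _
  set K := η / (1 - ρ)
  have hK : 0 < K := div_pos hη (by linarith)
  refine ⟨E * C₁ + σ ^ 2 * (K ^ 2 * E * C₂), by positivity, fun N hN _ hgap => ?_⟩
  set t0 := Nat.floor (ρ * (N : ℝ))
  have hN1 : 1 ≤ N := by omega
  have hN1' : (1 : ℝ) ≤ N := by exact_mod_cast hN1
  have hN0 : (0 : ℝ) < N := by linarith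
  have ht0 : t0 < N := by omega
  have ht0ρ : (t0 : ℝ) ≤ ρ * N := Nat.floor_le (by positivity)
  have hL : 1 ≤ 1 + Real.log N := by linarith [Real.log_nonneg hN1']
  set L := 1 + Real.log N
  have hlam : ∀ k : ℕ, ((k : ℝ) + 1) ^ (-a) ≤ 1 := fun k =>
    Real.rpow_le_one_of_one_le_of_nonpos (by linarith [Nat.cast_nonneg (α := ℝ) k]) (by linarith)
  have bias : ∑' k : ℕ, ((k : ℝ) + 1) ^ (-b) *
      Real.exp (-2 * ((k : ℝ) + 1) ^ (-a) * ∑ i ∈ Icc 1 (N - 1), wsdStep η t0 N i) ≤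
        E * C₁ * L * (N : ℝ) ^ (-((b - 1) / a)) := by
    have hle : ∀ k : ℕ, ((k : ℝ) + 1) ^ (-b) *
        Real.exp (-2 * ((k : ℝ) + 1) ^ (-a) * ∑ i ∈ Icc 1 (N - 1), wsdStep η t0 N i) ≤
        E * (((k : ℝ) + 1) ^ (-b) * Real.exp (-(η / 2 * N * ((k : ℝ) + 1) ^ (-a)))) := by
      intro k
      have h := exp_neg_sum_wsdStep_le (p := 0) hη.le (by positivity) (hlam k) ht0 (by omega)
      rw [Nat.cast_zero, sub_zero, zero_add, sq, mul_div_cancel_right₀ _ hN0.ne'] at h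
      rw [mul_left_comm]
      gcongr
    have hs := (summable_rpow_mul_exp hb a (show 0 ≤ η / 2 * N by positivity)).mul_left E
    calc _ ≤ ∑' k : ℕ, E * (((k : ℝ) + 1) ^ (-b) *
          Real.exp (-(η / 2 * N * ((k : ℝ) + 1) ^ (-a)))) :=
          Summable.tsum_le_tsum hle (hs.of_nonneg_of_le (fun k => by positivity) hle) hs
      _ = E * _ := tsum_mul_left
      _ ≤ E * (C₁ * L * (N : ℝ) ^ (-((b - 1) / a))) := by
          gcongr
          exact hbias N N hN1 hN0 le_rfl
      _ = _ := by ring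
  have variance : ∑' k : ℕ, (((k : ℝ) + 1) ^ (-a)) ^ 2 *
      ∑ p ∈ Icc 1 (N - 1), (wsdStep η t0 N p) ^ 2 *
        Real.exp (-2 * ((k : ℝ) + 1) ^ (-a) *
          ∑ s ∈ Icc (p + 1) (N - 1), wsdStep η t0 N s) ≤
        K ^ 2 * E * C₂ * L ^ 2 * (N : ℝ) ^ (-((a - 1) / a)) := by
    have hle : ∀ k : ℕ, (((k : ℝ) + 1) ^ (-a)) ^ 2 *
        ∑ p ∈ Icc 1 (N - 1), (wsdStep η t0 N p) ^ 2 *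
          Real.exp (-2 * ((k : ℝ) + 1) ^ (-a) *
            ∑ s ∈ Icc (p + 1) (N - 1), wsdStep η t0 N s) ≤
        ∑ p ∈ Icc 1 (N - 1), K ^ 2 * E * (((N : ℝ) - p) / N) ^ 2 *
          (((k : ℝ) + 1) ^ (-(2 * a)) *
            Real.exp (-(η / 2 * (((N : ℝ) - p) ^ 2 / N) * ((k : ℝ) + 1) ^ (-a)))) := by
      intro k
      rw [mul_sum]
      refine sum_le_sum fun p hp => ?_
      have hpN : p < N := by
        have := (mem_Icc.mp hp).2
        omega
      have hpN' : (p : ℝ) < N := by exact_mod_cast hpN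
      have h := exp_neg_sum_wsdStep_le hη.le (by positivity) (hlam k) ht0 hpN
      have hup := wsdStep_upper (t := p) hη.le hρ1 hN1 ht0ρ hpN.le
      have hlow : 0 ≤ wsdStep η t0 N p :=
        le_trans (mul_nonneg (by positivity) (by linarith)) (wsdStep_lower hη.le ht0 hpN.le)
      have hpow : (((k : ℝ) + 1) ^ (-a)) ^ 2 = ((k : ℝ) + 1) ^ (-(2 * a)) := by
        rw [← Real.rpow_natCast, ← Real.rpow_mul (by positivity)]
        congr 1
        push_cast
        ring
      rw [hpow]
      calc _ ≤ ((k : ℝ) + 1) ^ (-(2 * a)) * ((K * (((N : ℝ) - p) / N)) ^ 2 *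
            (E * Real.exp (-(η / 2 * (((N : ℝ) - p) ^ 2 / N) * ((k : ℝ) + 1) ^ (-a))))) := by
            gcongr
        _ = _ := by ring
    have hsp : ∀ p ∈ Icc 1 (N - 1), Summable fun k : ℕ =>
        K ^ 2 * E * (((N : ℝ) - p) / N) ^ 2 * (((k : ℝ) + 1) ^ (-(2 * a)) *
          Real.exp (-(η / 2 * (((N : ℝ) - p) ^ 2 / N) * ((k : ℝ) + 1) ^ (-a)))) := fun p _ =>
      (summable_rpow_mul_exp (show 1 < 2 * a by linarith) a (by positivity)).mul_left _
    have hs := summable_sum hsp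
    calc _ ≤ _ := Summable.tsum_le_tsum hle
          (hs.of_nonneg_of_le (fun k => by positivity) hle) hs
      _ = _ := Summable.tsum_finsetSum hsp
      _ ≤ ∑ p ∈ Icc 1 (N - 1), K ^ 2 * E * C₂ * L * ((((N : ℝ) - p) / N) ^ 2 *
          (((N : ℝ) - p) ^ 2 / N) ^ (-((2 * a - 1) / a))) := by
          refine sum_le_sum fun p hp => ?_
          have hpN' : (p : ℝ) < N := by
            have := (mem_Icc.mp hp).2
            exact_mod_cast (by omega : p < N)
          have hq : 0 < (N : ℝ) - p := by linarith
          rw [tsum_mul_left]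
          calc _ ≤ K ^ 2 * E * (((N : ℝ) - p) / N) ^ 2 *
                (C₂ * L * (((N : ℝ) - p) ^ 2 / N) ^ (-((2 * a - 1) / a))) := by
                gcongr
                refine hvar N _ hN1 (by positivity) ?_
                rw [div_le_iff₀ hN0]
                nlinarith [Nat.cast_nonneg (α := ℝ) p]
            _ = _ := by ring
      _ ≤ K ^ 2 * E * C₂ * L * (L * (N : ℝ) ^ (-((a - 1) / a))) := by
          rw [← mul_sum]
          gcongr
          exact sum_sq_mul_rpow_le ha ha2.le hN1
      _ = _ := by ring
  have hX : 0 < (N : ℝ) ^ (-((b - 1) / a)) := by positivity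
  have hY : 0 < (N : ℝ) ^ (-((a - 1) / a)) := by positivity
  set X := (N : ℝ) ^ (-((b - 1) / a))
  set Y := (N : ℝ) ^ (-((a - 1) / a))
  set B := E * C₁
  set V := K ^ 2 * E * C₂
  have hB : 0 < B := by positivity
  have hV : 0 < V := by positivity
  calc _ ≤ B * L * X + σ ^ 2 * (V * L ^ 2 * Y) := by gcongr
    _ ≤ B * L ^ 2 * X + σ ^ 2 * (V * L ^ 2 * Y) := by
        gcongr
        nlinarith
    _ ≤ (B + σ ^ 2 * V) * L ^ 2 * (X + Y) := by
        have h1 : 0 ≤ B * L ^ 2 * Y := by positivity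
        have h2 : 0 ≤ σ ^ 2 * V * L ^ 2 * X := by positivity
        nlinarith
end

section
/- Let η ∈ ℝ, let (x_t)_{t≥0} be a sequence of real numbers, and define (w_t)_{t≥0} by w_0 = 0 and w_{t+1} = (1 − η)·w_t + η·x_t. Then for every integer N ≥ 1: (1/N)·Σ_{t=1}^{N} w_t = Σ_{k=0}^{N−1} ( (1 − (1 − η)^{N−k}) / N ) · x_k. -/
/-- Closed form of the exponential-moving-average recursion. -/
theorem sgd_iterate_eq_sum (η : ℝ) (x w : ℕ → ℝ) (hw0 : w 0 = 0)
    (hrec : ∀ t, w (t + 1) = (1 - η) * w t + η * x t) (n : ℕ) :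
    w (n + 1) = ∑ k ∈ Finset.range (n + 1), η * (1 - η) ^ (n - k) * x k := by
  induction n with
  | zero => simp [hrec, hw0]
  | succ n ih =>
    rw [hrec, ih, Finset.sum_range_succ _ (n + 1), Finset.mul_sum]
    congr 1
    · refine Finset.sum_congr rfl fun k hk => ?_
      rw [Nat.succ_sub (Nat.lt_succ_iff.mp (Finset.mem_range.mp hk)), pow_succ]
      ring
    · simp

/-- The sum of the first `n` iterates as a linear combination of the samples. -/
theorem sgd_sum_iterates_eq (η : ℝ) (x w : ℕ → ℝ) (hw0 : w 0 = 0)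
    (hrec : ∀ t, w (t + 1) = (1 - η) * w t + η * x t) (n : ℕ) :
    ∑ t ∈ Finset.Icc 1 n, w t = ∑ k ∈ Finset.range n, (1 - (1 - η) ^ (n - k)) * x k := by
  induction n with
  | zero => simp
  | succ n ih =>
    rw [Finset.sum_Icc_succ_top (by omega), ih, sgd_iterate_eq_sum η x w hw0 hrec,
      Finset.sum_range_succ, Finset.sum_range_succ _ n, ← add_assoc, ← Finset.sum_add_distrib]
    congr 1
    · refine Finset.sum_congr rfl fun k hk => ?_
      rw [Nat.succ_sub (Finset.mem_range.mp hk).le, pow_succ]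
      ring
    · simp

open Finset in
/-- Iterate averaging for the constant-step 1D SGD recursion: if `w 0 = 0` and
`w (t+1) = (1 − η) w t + η · x t`, then for `N ≥ 1`,
`(1/N) Σ_{t=1}^N w t = Σ_{k=0}^{N−1} ((1 − (1−η)^(N−k))/N) · x k`. -/
theorem sgd_1d_average_weights (η : ℝ) (x w : ℕ → ℝ) (hw0 : w 0 = 0)
    (hrec : ∀ t, w (t + 1) = (1 - η) * w t + η * x t)
    (N : ℕ) (hN : 1 ≤ N) :
    (1 / (N : ℝ)) * ∑ t ∈ Icc 1 N, w t
      = ∑ k ∈ Finset.range N, ((1 - (1 - η) ^ (N - k)) / (N : ℝ)) * x k := by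
  rw [sgd_sum_iterates_eq η x w hw0 hrec, Finset.mul_sum]
  exact Finset.sum_congr rfl fun k _ => by ring
end
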